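/- Let 0 < μ₂ < μ₁ < 1. Then inf_{z ∈ (0,1)} max( d(μ₁, z), d(μ₂, z) ) < inf_{z ∈ (0,1)} max( d(z, μ₁), d(z, μ₂) ). -/

import Mathlib

/-- The Kullback-Leibler divergence between Bernoulli distributions of
parameters `x` and `y`. -/
noncomputable def klBernoulli (x y : ℝ) : ℝ :=
  x * Real.log (x / y) + (1 - x) * Real.log ((1 - x) / (1 - y))

open Real Set

/-- negative entropy -/
noncomputable def nent (x : ℝ) : ℝ := x * log x + (1 - x) * log (1 - x)

/-- geometric mixture -/
noncomputable def gmx (p q x : ℝ) : ℝ := exp ((1 - x) * log p + x * log q)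

/-- arithmetic mixture -/
noncomputable def amx (p q x : ℝ) : ℝ := x * p + (1 - x) * q

lemma gmx_pos (p q x : ℝ) : 0 < gmx p q x := exp_pos _

lemma gmx_deriv (p q x : ℝ) :
    HasDerivAt (gmx p q) (gmx p q x * (log q - log p)) x := by
  unfold gmx
  have h : HasDerivAt (fun x : ℝ => (1 - x) * log p + x * log q) ((-1) * log p + 1 * log q) x :=
    (((hasDerivAt_id x).const_sub 1).mul_const _).add ((hasDerivAt_id x).mul_const _)
  have := h.exp
  convert this using 1
  ring

lemma amx_deriv (p q x : ℝ) : HasDerivAt (amx p q) (p - q) x := by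
  unfold amx
  have h : HasDerivAt (fun x : ℝ => x * p + (1 - x) * q) (1 * p + (-1) * q) x :=
    ((hasDerivAt_id x).mul_const _).add (((hasDerivAt_id x).const_sub 1).mul_const _)
  convert h using 1
  ring

lemma amx_mem {p q x : ℝ} (hq : 0 < q) (hqp : q < p) (hp : p < 1) (hx : x ∈ Icc (0:ℝ) 1) :
    0 < amx p q x ∧ amx p q x < 1 := by
  obtain ⟨h0, h1⟩ := hx
  unfold amx
  constructor <;> nlinarith

noncomputable def FF (p q x : ℝ) : ℝ :=
  -log (gmx p q x + gmx (1 - p) (1 - q) x)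
    - (x * nent p + (1 - x) * nent q - nent (amx p q x))

noncomputable def FF1 (p q x : ℝ) : ℝ :=
  -((gmx p q x * (log q - log p) + gmx (1 - p) (1 - q) x * (log (1 - q) - log (1 - p))) /
      (gmx p q x + gmx (1 - p) (1 - q) x))
    - (nent p - nent q - (log (amx p q x) - log (1 - amx p q x)) * (p - q))

noncomputable def FF2 (p q x : ℝ) : ℝ :=
  (p - q) ^ 2 / (amx p q x * (1 - amx p q x)) -
  ((log q - log p) - (log (1 - q) - log (1 - p))) ^ 2 * (gmx p q x * gmx (1 - p) (1 - q) x) /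
    (gmx p q x + gmx (1 - p) (1 - q) x) ^ 2

lemma nent_deriv {z : ℝ} (h0 : 0 < z) (h1 : z < 1) :
    HasDerivAt nent (log z - log (1 - z)) z := by
  unfold nent
  have h1' : (1 - z) ≠ 0 := by linarith
  have hs : HasDerivAt (fun z : ℝ => 1 - z) (-1) z := (hasDerivAt_id z).const_sub 1
  have h := ((hasDerivAt_id z).mul (hasDerivAt_log h0.ne')).add (hs.mul (hs.log h1'))
  refine h.congr_deriv ?_
  simp only [id]
  field_simp
  ring

lemma FF_deriv {p q x : ℝ} (hq : 0 < q) (hqp : q < p) (hp : p < 1) (hx : x ∈ Icc (0:ℝ) 1) :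
    HasDerivAt (FF p q) (FF1 p q x) x := by
  obtain ⟨z0, z1⟩ := amx_mem hq hqp hp hx
  have hA := gmx_pos p q x
  have hB := gmx_pos (1 - p) (1 - q) x
  have hS := ((gmx_deriv p q x).add (gmx_deriv (1 - p) (1 - q) x)).log (by
    simp only [Pi.add_apply]; positivity)
  have hl : HasDerivAt (fun x : ℝ => x * nent p + (1 - x) * nent q)
      (1 * nent p + (-1) * nent q) x :=
    ((hasDerivAt_id x).mul_const _).add (((hasDerivAt_id x).const_sub 1).mul_const _)
  have hn := (nent_deriv z0 z1).comp x (amx_deriv p q x)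
  have h := hS.neg.sub (hl.sub hn)
  refine h.congr_deriv ?_
  unfold FF1
  simp only [Pi.add_apply]
  ring

lemma FF1_deriv {p q x : ℝ} (hq : 0 < q) (hqp : q < p) (hp : p < 1) (hx : x ∈ Icc (0:ℝ) 1) :
    HasDerivAt (FF1 p q) (FF2 p q x) x := by
  obtain ⟨z0, z1⟩ := amx_mem hq hqp hp hx
  have z1' : 0 < 1 - amx p q x := by linarith
  have hA := gmx_pos p q x
  have hB := gmx_pos (1 - p) (1 - q) x
  have dA := gmx_deriv p q x
  have dB := gmx_deriv (1 - p) (1 - q) x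
  have dz := amx_deriv p q x
  have hS := ((dA.mul_const (log q - log p)).add
    (dB.mul_const (log (1 - q) - log (1 - p)))).div (dA.add dB) (by
    simp only [Pi.add_apply]; positivity)
  have hz := (((dz.log z0.ne').sub ((dz.const_sub 1).log z1'.ne')).mul_const (p - q)).const_sub
    (nent p - nent q)
  have h := hS.neg.sub hz
  refine h.congr_deriv ?_
  unfold FF2
  simp only [Pi.add_apply]
  generalize gmx p q x = A at *
  generalize gmx (1 - p) (1 - q) x = B at *
  generalize amx p q x = z at *
  have : A + B ≠ 0 := by positivity
  field_simp
  ring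

lemma FF_ends {p q : ℝ} (hq : 0 < q) (hqp : q < p) (hp : p < 1) :
    FF p q 0 = 0 ∧ FF p q 1 = 0 ∧ FF1 p q 0 = 0 ∧ FF1 p q 1 = 0 := by
  have hp0 : 0 < p := by linarith
  have hp1 : 0 < 1 - p := by linarith
  have hq1 : 0 < 1 - q := by linarith
  refine ⟨?_, ?_, ?_, ?_⟩ <;>
    simp [FF, FF1, gmx, amx, nent, exp_log, hp0, hp1, hq, hq1] <;> ring

/-- the sign function of the second derivative -/
noncomputable def GG (p q x : ℝ) : ℝ :=
  (p - q) ^ 2 * (gmx p q x / gmx (1 - p) (1 - q) x + 2 + gmx (1 - p) (1 - q) x / gmx p q x)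
  - ((log q - log p) - (log (1 - q) - log (1 - p))) ^ 2 * (amx p q x * (1 - amx p q x))

lemma FF2_eq {p q x : ℝ} (hq : 0 < q) (hqp : q < p) (hp : p < 1) (hx : x ∈ Icc (0:ℝ) 1) :
    ∃ c, 0 < c ∧ GG p q x = c * FF2 p q x := by
  obtain ⟨z0, z1⟩ := amx_mem hq hqp hp hx
  have z1' : 0 < 1 - amx p q x := by linarith
  have hA := gmx_pos p q x
  have hB := gmx_pos (1 - p) (1 - q) x
  refine ⟨(gmx p q x + gmx (1 - p) (1 - q) x) ^ 2 / (gmx p q x * gmx (1 - p) (1 - q) x) *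
    (amx p q x * (1 - amx p q x)), by positivity, ?_⟩
  unfold GG FF2
  generalize gmx p q x = A at *
  generalize gmx (1 - p) (1 - q) x = B at *
  generalize amx p q x = z at *
  have : A + B ≠ 0 := by positivity
  field_simp
  ring

lemma gmx_ratio_convex (a b c d : ℝ) :
    ConvexOn ℝ univ (fun x => gmx a b x / gmx c d x) := by
  refine ⟨convex_univ, ?_⟩
  intro x _ y _ s t hs ht hst
  have h := convexOn_exp.2 (mem_univ (((1 - x) * log a + x * log b) - ((1 - x) * log c + x * log d)))
    (mem_univ (((1 - y) * log a + y * log b) - ((1 - y) * log c + y * log d))) hs ht hst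
  simp only [gmx, ← exp_sub, smul_eq_mul] at *
  convert h using 2
  obtain rfl : t = 1 - s := by linarith
  ring

lemma GG_strict {p q x y z : ℝ} (hq : 0 < q) (hqp : q < p) (hp : p < 1)
    (hxy : x < y) (hyz : y < z) (hx : GG p q x ≤ 0) (hz : GG p q z ≤ 0) : GG p q y < 0 := by
  have hk : (log q - log p) - (log (1 - q) - log (1 - p)) < 0 := by
    have := log_lt_log hq hqp
    have := log_lt_log (show 0 < 1 - p by linarith) (show 1 - p < 1 - q by linarith)
    linarith
  have hk2 : 0 < ((log q - log p) - (log (1 - q) - log (1 - p))) ^ 2 := sq_pos_of_neg hk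
  unfold GG at *
  generalize ((log q - log p) - (log (1 - q) - log (1 - p))) ^ 2 = K at *
  have hd : 0 < z - x := by linarith
  obtain ⟨s, hs⟩ : ∃ s, s = (z - y) / (z - x) := ⟨_, rfl⟩
  have hs0 : 0 < s := by rw [hs]; apply div_pos <;> linarith
  have hs1 : s < 1 := by rw [hs, div_lt_one hd]; linarith
  have hy : y = s * x + (1 - s) * z := by rw [hs]; field_simp; ring
  have c1 := (gmx_ratio_convex p q (1 - p) (1 - q)).2 (mem_univ x) (mem_univ z) hs0.le
    (show 0 ≤ 1 - s by linarith) (by ring)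
  have c2 := (gmx_ratio_convex (1 - p) (1 - q) p q).2 (mem_univ x) (mem_univ z) hs0.le
    (show 0 ≤ 1 - s by linarith) (by ring)
  simp only [smul_eq_mul, ← hy] at c1 c2
  have hquad : amx p q y * (1 - amx p q y) = s * (amx p q x * (1 - amx p q x))
      + (1 - s) * (amx p q z * (1 - amx p q z)) + s * (1 - s) * ((p - q) * (z - x)) ^ 2 := by
    rw [hy]; unfold amx; ring
  have hpos : 0 < K * (s * (1 - s) * ((p - q) * (z - x)) ^ 2) := by
    have : 0 < p - q := by linarith
    have : 0 < 1 - s := by linarith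
    positivity
  rw [hquad]
  have h3 := mul_le_mul_of_nonneg_left (add_le_add c1 c2) (sq_nonneg (p - q))
  have h1 := mul_nonneg_of_nonpos_of_nonpos (neg_nonpos.2 hs0.le) hx
  have h2 := mul_nonneg_of_nonpos_of_nonpos (neg_nonpos.2 (show 0 ≤ 1 - s by linarith)) hz
  nlinarith

lemma FF_pos {p q x : ℝ} (hq : 0 < q) (hqp : q < p) (hp : p < 1) (hx : x ∈ Ioo (0:ℝ) 1) :
    0 < FF p q x := by
  obtain ⟨e1, e2, e3, e4⟩ := FF_ends hq hqp hp
  obtain ⟨x0, x1⟩ := hx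
  by_contra! hF
  have mvt : ∀ (f f' : ℝ → ℝ), (∀ x ∈ Icc (0:ℝ) 1, HasDerivAt f (f' x) x) → ∀ a b : ℝ, 0 ≤ a →
      a < b → b ≤ 1 → ∃ c ∈ Ioo a b, f' c * (b - a) = f b - f a := by
    intro f f' h a b ha hab hb
    obtain ⟨c, hc, h2⟩ := exists_hasDerivAt_eq_slope f f' hab
      (fun y hy => (h y ⟨ha.trans hy.1, hy.2.trans hb⟩).continuousAt.continuousWithinAt)
      (fun y hy => h y ⟨ha.trans hy.1.le, hy.2.le.trans hb⟩)
    refine ⟨c, hc, ?_⟩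
    have : b - a ≠ 0 := by linarith
    rw [h2]; field_simp
  have m1 := mvt _ _ (fun x hx => FF_deriv hq hqp hp hx)
  have m2 := mvt _ _ (fun x hx => FF1_deriv hq hqp hp hx)
  obtain ⟨a, ⟨ha0, ha1⟩, ha⟩ := m1 0 x le_rfl x0 x1.le
  obtain ⟨b, ⟨hb0, hb1⟩, hb⟩ := m1 x 1 x0.le x1 le_rfl
  have ha' : FF1 p q a ≤ 0 := by
    by_contra! h
    nlinarith [mul_pos h x0]
  have hb' : 0 ≤ FF1 p q b := by
    by_contra! h
    nlinarith [mul_pos (neg_pos.2 h) (sub_pos.2 x1)]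
  obtain ⟨u, ⟨hu0, hu1⟩, hu⟩ := m2 0 a le_rfl ha0 (by linarith)
  obtain ⟨v, ⟨hv0, hv1⟩, hv⟩ := m2 a b ha0.le (by linarith) hb1.le
  obtain ⟨w, ⟨hw0, hw1⟩, hw⟩ := m2 b 1 (by linarith) hb1 le_rfl
  obtain ⟨cu, cu0, hcu⟩ := FF2_eq (x := u) hq hqp hp ⟨by linarith, by linarith⟩
  obtain ⟨cv, cv0, hcv⟩ := FF2_eq (x := v) hq hqp hp ⟨by linarith, by linarith⟩
  obtain ⟨cw, cw0, hcw⟩ := FF2_eq (x := w) hq hqp hp ⟨by linarith, by linarith⟩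
  have hu' : FF2 p q u ≤ 0 := by
    by_contra! h
    nlinarith [mul_pos h ha0]
  have hw' : FF2 p q w ≤ 0 := by
    by_contra! h
    nlinarith [mul_pos h (sub_pos.2 hb1)]
  have hv' : 0 ≤ FF2 p q v := by
    by_contra! h
    nlinarith [mul_pos (neg_pos.2 h) (sub_pos.2 (hv0.trans hv1))]
  have := GG_strict hq hqp hp (show u < v by linarith) (show v < w by linarith)
    (by rw [hcu]; exact mul_nonpos_of_nonneg_of_nonpos cu0.le hu')
    (by rw [hcw]; exact mul_nonpos_of_nonneg_of_nonpos cw0.le hw')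
  rw [hcv] at this
  nlinarith [mul_nonneg cv0.le hv']

lemma kl_expand {x y : ℝ} (hx : x ∈ Ioo (0:ℝ) 1) (hy : y ∈ Ioo (0:ℝ) 1) :
    klBernoulli x y = nent x - x * log y - (1 - x) * log (1 - y) := by
  obtain ⟨h1, h2⟩ := hx
  obtain ⟨h3, h4⟩ := hy
  unfold klBernoulli nent
  rw [log_div h1.ne' h3.ne', log_div (by linarith) (by linarith)]
  ring

/-- Gibbs-type inequality -/
lemma gibbs {w A B : ℝ} (hw : w ∈ Ioo (0:ℝ) 1) (hA : 0 < A) (hB : 0 < B) :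
    -log (A + B) ≤ nent w - w * log A - (1 - w) * log B := by
  obtain ⟨h1, h2⟩ := hw
  have h3 : 0 < 1 - w := by linarith
  have h := strictConcaveOn_log_Ioi.concaveOn.2 (show A / w ∈ Ioi (0:ℝ) from div_pos hA h1)
    (show B / (1 - w) ∈ Ioi (0:ℝ) from div_pos hB h3) h1.le h3.le (by ring)
  simp only [smul_eq_mul] at h
  rw [mul_div_cancel₀ _ h1.ne', mul_div_cancel₀ _ h3.ne', log_div hA.ne' h1.ne',
    log_div hB.ne' h3.ne'] at h
  unfold nent
  linarith

lemma kl_pos {x y : ℝ} (hx : x ∈ Ioo (0:ℝ) 1) (hy : y ∈ Ioo (0:ℝ) 1) (hxy : x ≠ y) :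
    0 < klBernoulli x y := by
  rw [kl_expand hx hy]
  obtain ⟨h1, h2⟩ := hx
  obtain ⟨h3, h4⟩ := hy
  have a := log_lt_sub_one_of_pos (div_pos h3 h1) (by
    intro h; rw [div_eq_one_iff_eq h1.ne'] at h; exact hxy h.symm)
  have b := log_le_sub_one_of_pos (div_pos (show 0 < 1 - y by linarith) (show 0 < 1 - x by linarith))
  rw [log_div h3.ne' h1.ne'] at a
  rw [log_div (by linarith) (by linarith)] at b
  have a' := mul_lt_mul_of_pos_left a h1
  have b' := mul_le_mul_of_nonneg_left b (show 0 ≤ 1 - x by linarith)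
  rw [mul_sub, mul_sub, mul_div_cancel₀ _ h1.ne'] at a'
  rw [mul_sub, mul_sub, mul_div_cancel₀ _ (show 1 - x ≠ 0 by linarith)] at b'
  unfold nent
  linarith

theorem stmt_17 (μ₁ μ₂ : ℝ) (h₂ : 0 < μ₂) (h₁₂ : μ₂ < μ₁) (h₁ : μ₁ < 1) :
    sInf {v : ℝ | ∃ z ∈ Set.Ioo (0 : ℝ) 1,
        v = max (klBernoulli μ₁ z) (klBernoulli μ₂ z)} <
      sInf {v : ℝ | ∃ z ∈ Set.Ioo (0 : ℝ) 1,
        v = max (klBernoulli z μ₁) (klBernoulli z μ₂)} := by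
  have m1 : μ₁ ∈ Ioo (0:ℝ) 1 := ⟨by linarith, h₁⟩
  have m2 : μ₂ ∈ Ioo (0:ℝ) 1 := ⟨h₂, by linarith⟩
  have mz : ∀ x ∈ Icc (0:ℝ) 1, amx μ₁ μ₂ x ∈ Ioo (0:ℝ) 1 := fun x hx => amx_mem h₂ h₁₂ h₁ hx
  -- the equalizing point
  obtain ⟨x, hx, hxe⟩ : ∃ x ∈ Ioo (0:ℝ) 1,
      klBernoulli μ₁ (amx μ₁ μ₂ x) = klBernoulli μ₂ (amx μ₁ μ₂ x) := by
    have hc : ContinuousOn (fun x => (nent μ₁ - μ₁ * log (amx μ₁ μ₂ x) -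
        (1 - μ₁) * log (1 - amx μ₁ μ₂ x)) - (nent μ₂ - μ₂ * log (amx μ₁ μ₂ x) -
        (1 - μ₂) * log (1 - amx μ₁ μ₂ x))) (Icc 0 1) := by
      have ha : ContinuousOn (amx μ₁ μ₂) (Icc 0 1) := fun y _ =>
        (amx_deriv μ₁ μ₂ y).continuousAt.continuousWithinAt
      have hl1 := ha.log (fun y hy => (mz y hy).1.ne')
      have hl2 := (continuousOn_const (c := (1:ℝ)).sub ha).log
        (fun y hy => by have := (mz y hy).2; simp only [ne_eq, Pi.sub_apply]; linarith)
      fun_prop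
    have h0 := mz 0 (by simp)
    have h1 := mz 1 (by simp)
    have k1 := kl_pos m1 m2 h₁₂.ne'
    have k2 := kl_pos m2 m1 h₁₂.ne
    rw [kl_expand m1 m2] at k1
    rw [kl_expand m2 m1] at k2
    have iv := intermediate_value_Ioo' (zero_le_one (α := ℝ)) hc
    obtain ⟨x, hx, hxe⟩ := iv (show (0:ℝ) ∈ _ by
      constructor
      · simp only [amx, nent] at *; norm_num; linarith
      · simp only [amx, nent] at *; norm_num; linarith)
    refine ⟨x, hx, ?_⟩
    have hm := mz x ⟨hx.1.le, hx.2.le⟩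
    rw [kl_expand m1 hm, kl_expand m2 hm]
    exact sub_eq_zero.1 hxe
  have hm := mz x ⟨hx.1.le, hx.2.le⟩
  have hpos := FF_pos h₂ h₁₂ h₁ hx
  have hval : klBernoulli μ₁ (amx μ₁ μ₂ x) =
      x * nent μ₁ + (1 - x) * nent μ₂ - nent (amx μ₁ μ₂ x) := by
    have : klBernoulli μ₁ (amx μ₁ μ₂ x) = x * klBernoulli μ₁ (amx μ₁ μ₂ x)
        + (1 - x) * klBernoulli μ₂ (amx μ₁ μ₂ x) := by rw [← hxe]; ring
    rw [this, kl_expand m1 hm, kl_expand m2 hm]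
    have e : nent (amx μ₁ μ₂ x) = (x * μ₁ + (1 - x) * μ₂) * log (amx μ₁ μ₂ x)
      + (1 - (x * μ₁ + (1 - x) * μ₂)) * log (1 - amx μ₁ μ₂ x) := rfl
    rw [e]; ring
  have upper : sInf {v : ℝ | ∃ z ∈ Set.Ioo (0 : ℝ) 1,
        v = max (klBernoulli μ₁ z) (klBernoulli μ₂ z)} ≤ klBernoulli μ₁ (amx μ₁ μ₂ x) := by
    apply csInf_le
    · refine ⟨0, ?_⟩
      rintro v ⟨z, hz, rfl⟩
      by_cases h : μ₁ = z
      · exact le_max_of_le_right (kl_pos m2 hz (by rw [← h]; exact h₁₂.ne)).le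
      · exact le_max_of_le_left (kl_pos m1 hz h).le
    · exact ⟨_, hm, by rw [← hxe, max_self]⟩
  have lower : -log (gmx μ₁ μ₂ x + gmx (1 - μ₁) (1 - μ₂) x) ≤
      sInf {v : ℝ | ∃ z ∈ Set.Ioo (0 : ℝ) 1,
        v = max (klBernoulli z μ₁) (klBernoulli z μ₂)} := by
    apply le_csInf
    · exact ⟨_, μ₁, m1, rfl⟩
    · rintro v ⟨w, hw, rfl⟩
      have g := gibbs hw (gmx_pos μ₁ μ₂ x) (gmx_pos (1 - μ₁) (1 - μ₂) x)
      have l1 := mul_le_mul_of_nonneg_left (le_max_left (klBernoulli w μ₁) (klBernoulli w μ₂))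
        (show 0 ≤ 1 - x by linarith [hx.2])
      have l2 := mul_le_mul_of_nonneg_left (le_max_right (klBernoulli w μ₁) (klBernoulli w μ₂))
        hx.1.le
      have e : nent w - w * log (gmx μ₁ μ₂ x) - (1 - w) * log (gmx (1 - μ₁) (1 - μ₂) x)
          = (1 - x) * klBernoulli w μ₁ + x * klBernoulli w μ₂ := by
        rw [kl_expand hw m1, kl_expand hw m2]
        unfold gmx
        rw [log_exp, log_exp]; ring
      linarith
  unfold FF at hpos
  linarith
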